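/- arXiv:1604.08269 — 7 statements merged into one kernel-verified Lean document; each statement's English description precedes it below -/
import Mathlib

section
/- Let p ≥ 1 and m ≥ 1 be integers and let f_1, …, f_m : {1,…,p+1} → ℝ be functions satisfying the discrete-derivative dominance condition: for every 1 ≤ j < m and every 1 ≤ i ≤ p, f_{j+1}(i+1) − f_{j+1}(i) ≥ f_j(i+1) − f_j(i). For each j define opt_j to be the largest element of the set argmax_{1 ≤ i ≤ p+1} f_j(i). Then the sequence opt_1, opt_2, …, opt_m is nondecreasing, i.e. opt_j ≤ opt_{j+1} for all 1 ≤ j < m. -/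
/-- If the functions `f 1, …, f m : {1,…,p+1} → ℝ` satisfy the
discrete-derivative dominance condition (C2), and `opt j` is the largest element
of `argmax f j` over `{1,…,p+1}`, then `opt` is nondecreasing. -/
theorem stmt_0 (p m : ℕ) (hp : 1 ≤ p) (hm : 1 ≤ m)
    (f : ℕ → ℕ → ℝ)
    (hC2 : ∀ j, 1 ≤ j → j < m → ∀ i, 1 ≤ i → i ≤ p →
      f j (i + 1) - f j i ≤ f (j + 1) (i + 1) - f (j + 1) i)
    (opt : ℕ → ℕ)
    (hmem : ∀ j, 1 ≤ j → j ≤ m → opt j ∈ Finset.Icc 1 (p + 1))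
    (hmax : ∀ j, 1 ≤ j → j ≤ m → ∀ i ∈ Finset.Icc 1 (p + 1), f j i ≤ f j (opt j))
    (hlargest : ∀ j, 1 ≤ j → j ≤ m → ∀ i ∈ Finset.Icc 1 (p + 1),
      f j i = f j (opt j) → i ≤ opt j) :
    ∀ j, 1 ≤ j → j < m → opt j ≤ opt (j + 1) := by
  intro j hj1 hjm
  by_contra hlt
  have hlt : opt (j + 1) < opt j := not_le.mp hlt
  have ha := hmem j hj1 hjm.le
  have hb := hmem (j + 1) (by omega) hjm
  have ha2 := Finset.mem_Icc.mp ha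
  have hb2 := Finset.mem_Icc.mp hb
  have key : ∀ k, opt (j + 1) ≤ k → k ≤ p + 1 →
      f j k - f j (opt (j + 1)) ≤ f (j + 1) k - f (j + 1) (opt (j + 1)) := by
    intro k hk
    induction k, hk using Nat.le_induction with
    | base => intro _; simp
    | succ k hk ih =>
      intro hkp
      have h1 := ih (by omega)
      have h2 := hC2 j hj1 hjm k (by omega) (by omega)
      linarith
  have h1 := key (opt j) hlt.le ha2.2
  have h2 := hmax j hj1 hjm.le _ hb
  have h3 := hmax (j + 1) (by omega) hjm _ ha
  have h4 := hlargest (j + 1) (by omega) hjm _ ha (by linarith)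
  omega
end

section
/- Fix integers p ≥ 1 and n ≥ 1, scores s⁺ : {1,…,p} → ℝ and s* : {1,…,n} → ℝ, and a vector of interleaving ranks r : {1,…,n} → {1,…,p+1}. For 1 ≤ i ≤ p define the interleaving rank of the i-th positive sample as r⁺_i = 1 + |{j : r_j ≤ i}|, and set c⁺_i = (n + 2 − 2 r⁺_i)/(pn) and c⁻_j = (p + 2 − 2 r_j)/(pn). Then the joint score satisfies F = Σ_{i=1}^{p} c⁺_i · s⁺_i + Σ_{j=1}^{n} c⁻_j · s*_j. -/
/-- decomposition of the joint score into per-sample contributions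
`c⁺_i s⁺_i` and `c⁻_j s*_j` determined by the interleaving ranks. -/
theorem stmt_3 (p n : ℕ) (hp : 1 ≤ p) (hn : 1 ≤ n)
    (spos sneg : ℕ → ℝ) (r : ℕ → ℕ)
    (hr : ∀ j ∈ Finset.Icc 1 n, r j ∈ Finset.Icc 1 (p + 1)) :
    (1 / ((p : ℝ) * n)) *
      ∑ i ∈ Finset.Icc 1 p, ∑ j ∈ Finset.Icc 1 n,
        (if i < r j then (1 : ℝ) else -1) * (spos i - sneg j)
    = ∑ i ∈ Finset.Icc 1 p,
        (((n : ℝ) + 2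
            - 2 * (((1 + (((Finset.Icc 1 n).filter (fun j => r j ≤ i)).card) : ℕ) : ℝ)))
          / ((p : ℝ) * n)) * spos i
      + ∑ j ∈ Finset.Icc 1 n,
        (((p : ℝ) + 2 - 2 * (r j : ℝ)) / ((p : ℝ) * n)) * sneg j := by
  have hR : ∀ i j, (if i < r j then (1 : ℝ) else -1) = 1 - 2 * (if r j ≤ i then (1 : ℝ) else 0) := by
    intro i j
    by_cases h : i < r j
    · rw [if_pos h, if_neg (by omega)]; norm_num
    · rw [if_neg h, if_pos (by omega)]; norm_num
  have h1 : ∀ i, ∑ j ∈ Finset.Icc 1 n, (if i < r j then (1 : ℝ) else -1)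
      = n - 2 * (((Finset.Icc 1 n).filter (fun j => r j ≤ i)).card : ℝ) := by
    intro i
    simp only [hR, Finset.sum_sub_distrib, ← Finset.mul_sum, Finset.sum_boole]
    simp
  have h2 : ∀ j ∈ Finset.Icc 1 n, ∑ i ∈ Finset.Icc 1 p, (if i < r j then (1 : ℝ) else -1)
      = -((p : ℝ) + 2 - 2 * (r j : ℝ)) := by
    intro j hj
    have hj' := Finset.mem_Icc.1 (hr j hj)
    simp only [hR, Finset.sum_sub_distrib, ← Finset.mul_sum, Finset.sum_boole]
    have : (Finset.Icc 1 p).filter (fun i => r j ≤ i) = Finset.Icc (r j) p := by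
      ext i
      simp only [Finset.mem_filter, Finset.mem_Icc]
      omega
    rw [this, Nat.card_Icc, Nat.cast_sub hj'.2]
    simp
    ring
  have h3 : ∑ i ∈ Finset.Icc 1 p, ∑ j ∈ Finset.Icc 1 n,
        (if i < r j then (1 : ℝ) else -1) * (spos i - sneg j)
      = ∑ i ∈ Finset.Icc 1 p, (∑ j ∈ Finset.Icc 1 n, (if i < r j then (1 : ℝ) else -1)) * spos i
        - ∑ j ∈ Finset.Icc 1 n,
          (∑ i ∈ Finset.Icc 1 p, (if i < r j then (1 : ℝ) else -1)) * sneg j := by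
    simp only [mul_sub, Finset.sum_sub_distrib, Finset.sum_mul]
    congr 1
    exact Finset.sum_comm
  rw [h3, mul_sub, Finset.mul_sum, Finset.mul_sum, sub_eq_add_neg, ← Finset.sum_neg_distrib]
  congr 1
  · refine Finset.sum_congr rfl fun i _ => ?_
    rw [h1]
    push_cast
    ring
  · refine Finset.sum_congr rfl fun j hj => ?_
    rw [h2 j hj]
    ring
end

section
/- Fix integers p ≥ 1 and n ≥ 1, scores a : Fin p → ℝ on the positive samples and b : Fin n → ℝ on the negative samples, and a ranking given by a bijection π : Fin (p+n) ≃ (Fin p ⊕ Fin n) (π(t) is the sample at position t). Define R_{i,j}(π) = 1 if positive sample i appears before negative sample j under π (i.e. π⁻¹(inl i) < π⁻¹(inr j)) and R_{i,j}(π) = −1 otherwise, and F(π) = (1/(pn)) · Σ_{i,j} R_{i,j}(π) (a_i − b_j). Define rank(i) = 1 + |{j : π⁻¹(inr j) < π⁻¹(inl i)}| for a positive sample i and rank(j) = 1 + |{i : π⁻¹(inl i) < π⁻¹(inr j)}| for a negative sample j. Then F(π) = Σ_{i ∈ Fin p} ((n + 2 − 2·rank(i))/(pn)) · a_i + Σ_{j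 ∈ Fin n} ((p + 2 − 2·rank(j))/(pn)) · b_j. -/
/-- decomposition of the joint score of an arbitrary ranking
(encoded as a bijection `π : Fin (p+n) ≃ Fin p ⊕ Fin n`) into per-sample
contributions weighted by the samples' interleaving ranks. -/
theorem stmt_4 (p n : ℕ) (hp : 1 ≤ p) (hn : 1 ≤ n)
    (a : Fin p → ℝ) (b : Fin n → ℝ)
    (π : Fin (p + n) ≃ (Fin p ⊕ Fin n)) :
    (1 / ((p : ℝ) * n)) * ∑ i : Fin p, ∑ j : Fin n,
        (if π.symm (Sum.inl i) < π.symm (Sum.inr j) then (1 : ℝ) else -1) * (a i - b j)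
    = ∑ i : Fin p,
        (((n : ℝ) + 2 - 2 * (((1 + (Finset.univ.filter
              (fun j : Fin n => π.symm (Sum.inr j) < π.symm (Sum.inl i))).card : ℕ) : ℝ)))
          / ((p : ℝ) * n)) * a i
      + ∑ j : Fin n,
        (((p : ℝ) + 2 - 2 * (((1 + (Finset.univ.filter
              (fun i : Fin p => π.symm (Sum.inl i) < π.symm (Sum.inr j))).card : ℕ) : ℝ)))
          / ((p : ℝ) * n)) * b j := by
  have hA : ∀ i : Fin p, ∑ j : Fin n,
      (if π.symm (Sum.inl i) < π.symm (Sum.inr j) then (1 : ℝ) else -1)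
      = (n : ℝ) - 2 * ((Finset.univ.filter
          (fun j : Fin n => π.symm (Sum.inr j) < π.symm (Sum.inl i))).card : ℝ) := by
    intro i
    have h1 : ∀ j : Fin n,
        (if π.symm (Sum.inl i) < π.symm (Sum.inr j) then (1 : ℝ) else -1)
        = 1 - 2 * (if π.symm (Sum.inr j) < π.symm (Sum.inl i) then (1 : ℝ) else 0) := by
      intro j
      have hne : π.symm (Sum.inl i) ≠ π.symm (Sum.inr j) := by
        intro h
        simpa using π.symm.injective h
      rcases lt_or_gt_of_ne hne with h | h
      · rw [if_pos h, if_neg (not_lt.mpr h.le)]; norm_num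
      · rw [if_neg (not_lt.mpr h.le), if_pos h]; norm_num
    rw [Finset.sum_congr rfl (fun j _ => h1 j), Finset.sum_sub_distrib, ← Finset.mul_sum,
      Finset.sum_boole]
    simp
  have hB : ∀ j : Fin n, ∑ i : Fin p,
      (if π.symm (Sum.inl i) < π.symm (Sum.inr j) then (1 : ℝ) else -1)
      = 2 * ((Finset.univ.filter
          (fun i : Fin p => π.symm (Sum.inl i) < π.symm (Sum.inr j))).card : ℝ) - p := by
    intro j
    have h1 : ∀ i : Fin p,
        (if π.symm (Sum.inl i) < π.symm (Sum.inr j) then (1 : ℝ) else -1)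
        = 2 * (if π.symm (Sum.inl i) < π.symm (Sum.inr j) then (1 : ℝ) else 0) - 1 := by
      intro i
      split_ifs <;> norm_num
    rw [Finset.sum_congr rfl (fun i _ => h1 i), Finset.sum_sub_distrib, ← Finset.mul_sum,
      Finset.sum_boole]
    simp
  simp only [mul_sub, Finset.sum_sub_distrib]
  rw [Finset.sum_comm (f := fun (i : Fin p) (j : Fin n) =>
    (if π.symm (Sum.inl i) < π.symm (Sum.inr j) then (1 : ℝ) else -1) * b j)]
  simp only [← Finset.sum_mul, hA, hB]
  rw [Finset.mul_sum, Finset.mul_sum, sub_eq_add_neg, ← Finset.sum_neg_distrib]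
  congr 1
  · refine Finset.sum_congr rfl fun i _ => ?_
    push_cast
    ring
  · refine Finset.sum_congr rfl fun j _ => ?_
    push_cast
    ring
end

section
/- Fix integers p ≥ 1 and n ≥ 1, a discount function D : {1,…,p+n} → ℝ, and a nondecreasing vector of interleaving ranks r : {1,…,n} → {1,…,p+1} (r_j ≤ r_{j+1} for all 1 ≤ j < n). Let C = Σ_{i=1}^{p} D(i) and assume C ≠ 0. For 1 ≤ i ≤ p let k_i = |{j : r_j ≤ i}|. Then the NDCG loss decomposes over the negative samples: 1 − (1/C) · Σ_{i=1}^{p} D(i + k_i) = (1/C) · Σ_{j=1}^{n} [ D(r_j + j − 1) − D(p + j) ]. In other words, with δ_j(i) = (1/C)(D(i + j − 1) − D(p + j)), the loss equals Σ_{j=1}^{n} δ_j(r_j). -/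
lemma tele_aux (f : ℕ → ℝ) (r : ℕ) (hr : 1 ≤ r) (p : ℕ) :
    ∑ i ∈ Finset.Icc 1 p, (if r ≤ i then f (i + 1) - f i else 0)
      = if r ≤ p + 1 then f (p + 1) - f r else 0 := by
  induction p with
  | zero =>
    by_cases h : r ≤ 1
    · obtain rfl : r = 1 := by omega
      simp
    · simp [h]
  | succ p ih =>
    rw [Finset.sum_Icc_succ_top (by omega), ih]
    by_cases h : r ≤ p + 1
    · have h2 : r ≤ p + 1 + 1 := by omega
      simp only [h, h2, if_true]
      ring
    · by_cases h2 : r ≤ p + 1 + 1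
      · obtain rfl : r = p + 1 + 1 := by omega
        simp
      · simp [h, h2]

lemma key_aux (p : ℕ) (D : ℕ → ℝ) (r : ℕ → ℕ) (n : ℕ)
    (hr : ∀ j ∈ Finset.Icc 1 n, r j ∈ Finset.Icc 1 (p + 1))
    (hmono : ∀ j, 1 ≤ j → j < n → r j ≤ r (j + 1)) :
    ∑ i ∈ Finset.Icc 1 p, D (i + ((Finset.Icc 1 n).filter (fun j => r j ≤ i)).card)
      = ∑ i ∈ Finset.Icc 1 p, D i - ∑ j ∈ Finset.Icc 1 n, (D (r j + j - 1) - D (p + j)) := by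
  induction n with
  | zero => simp
  | succ n ih =>
    have ih := ih (fun j hj => hr j (by simp only [Finset.mem_Icc] at *; omega))
      (fun j h1 h2 => hmono j h1 (by omega))
    have hle : ∀ k j, 1 ≤ j → j + k = n + 1 → r j ≤ r (n + 1) := by
      intro k
      induction k with
      | zero =>
        intro j _ h
        obtain rfl : j = n + 1 := by omega
        exact le_rfl
      | succ k ihk =>
        intro j h1 h
        exact (hmono j h1 (by omega)).trans (ihk (j + 1) (by omega) (by omega))
    have hrn := Finset.mem_Icc.1 (hr (n + 1) (by simp))
    have ht := tele_aux (fun i => D (i + n)) (r (n + 1)) hrn.1 p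
    rw [if_pos hrn.2] at ht
    have hstep : ∑ i ∈ Finset.Icc 1 p,
          D (i + ((Finset.Icc 1 (n + 1)).filter (fun j => r j ≤ i)).card)
        = ∑ i ∈ Finset.Icc 1 p, D (i + ((Finset.Icc 1 n).filter (fun j => r j ≤ i)).card)
          + ∑ i ∈ Finset.Icc 1 p,
            (if r (n + 1) ≤ i then D (i + 1 + n) - D (i + n) else 0) := by
      rw [← Finset.sum_add_distrib]
      refine Finset.sum_congr rfl fun i _ => ?_
      by_cases h : r (n + 1) ≤ i
      · have e : ∀ m, m ≤ n + 1 → (Finset.Icc 1 m).filter (fun j => r j ≤ i) = Finset.Icc 1 m := by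
          intro m hm
          refine Finset.filter_true_of_mem fun j hj => ?_
          rw [Finset.mem_Icc] at hj
          exact (hle (n + 1 - j) j hj.1 (by omega)).trans h
        rw [e _ le_rfl, e n (by omega), if_pos h]
        simp only [Nat.card_Icc, Nat.add_sub_cancel]
        rw [show i + 1 + n = i + (n + 1) by omega]
        ring
      · rw [if_neg h, add_zero]
        congr 3
        ext j
        simp only [Finset.mem_filter, Finset.mem_Icc]
        constructor
        · rintro ⟨⟨a, b⟩, c⟩
          have : j ≠ n + 1 := by rintro rfl; exact h c
          exact ⟨⟨a, by omega⟩, c⟩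
        · rintro ⟨⟨a, b⟩, c⟩
          exact ⟨⟨a, by omega⟩, c⟩
    rw [hstep, ih, ht, Finset.sum_Icc_succ_top (by omega : 1 ≤ n + 1)]
    rw [show r (n + 1) + (n + 1) - 1 = r (n + 1) + n by omega,
      show p + (n + 1) = p + 1 + n by omega]
    ring


/-- decomposition of the NDCG loss over the negative samples. -/
theorem stmt_5 (p n : ℕ) (hp : 1 ≤ p) (hn : 1 ≤ n)
    (D : ℕ → ℝ) (r : ℕ → ℕ)
    (hr : ∀ j ∈ Finset.Icc 1 n, r j ∈ Finset.Icc 1 (p + 1))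
    (hmono : ∀ j, 1 ≤ j → j < n → r j ≤ r (j + 1))
    (hC : (∑ i ∈ Finset.Icc 1 p, D i) ≠ 0) :
    1 - (1 / ∑ i ∈ Finset.Icc 1 p, D i) *
        ∑ i ∈ Finset.Icc 1 p, D (i + ((Finset.Icc 1 n).filter (fun j => r j ≤ i)).card)
    = (1 / ∑ i ∈ Finset.Icc 1 p, D i) *
        ∑ j ∈ Finset.Icc 1 n, (D (r j + j - 1) - D (p + j)) := by


  rw [key_aux p D r n hr hmono]
  field_simp
  ring
end

section
/- Fix integers p ≥ 1 and n ≥ 1 and a nondecreasing vector of interleaving ranks r : {1,…,n} → {1,…,p+1} (r_j ≤ r_{j+1} for all 1 ≤ j < n). For 1 ≤ i ≤ p let k_i = |{j : r_j ≤ i}|, and for 1 ≤ j ≤ n and 1 ≤ i ≤ p+1 define δ_j(i) = (1/p) · Σ_{k=i}^{p} ( j/(j+k) − (j−1)/(j+k−1) ) (an empty sum when i = p+1). Then the AP loss decomposes over the negative samples: 1 − (1/p) · Σ_{i=1}^{p} i/(i + k_i) = Σ_{j=1}^{n} δ_j(r_j). -/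
theorem inner_tele (i : ℕ) (hi : 1 ≤ i) (r : ℕ → ℕ) (n : ℕ)
    (hmono : ∀ j, 1 ≤ j → j < n → r j ≤ r (j + 1)) :
    ∑ j ∈ (Finset.Icc 1 n).filter (fun j => r j ≤ i),
        ((j : ℝ) / ((j : ℝ) + (i : ℝ)) - ((j : ℝ) - 1) / ((j : ℝ) + (i : ℝ) - 1))
    = 1 - (i : ℝ) / ((i : ℝ) + ((((Finset.Icc 1 n).filter (fun j => r j ≤ i)).card : ℕ) : ℝ)) := by
  have hi' : (1 : ℝ) ≤ i := by exact_mod_cast hi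
  induction n with
  | zero =>
    have : (i : ℝ) ≠ 0 := by positivity
    simp [this]
  | succ n ih =>
    have ih := ih (fun j h1 h2 => hmono j h1 (by omega))
    have hins : Finset.Icc 1 (n + 1) = insert (n + 1) (Finset.Icc 1 n) := by
      ext x; simp only [Finset.mem_Icc, Finset.mem_insert]; omega
    rw [hins, Finset.filter_insert]
    by_cases h : r (n + 1) ≤ i
    · have hall : ∀ m, m ≤ n → r (n + 1 - m) ≤ i := by
        intro m
        induction m with
        | zero => intro _; simpa using h
        | succ m ihm =>
          intro hm
          have h1 := ihm (by omega)
          have h2 := hmono (n + 1 - (m + 1)) (by omega) (by omega)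
          have h3 : n + 1 - (m + 1) + 1 = n + 1 - m := by omega
          rw [h3] at h2
          omega
      have hf : (Finset.Icc 1 n).filter (fun j => r j ≤ i) = Finset.Icc 1 n := by
        apply Finset.filter_true_of_mem
        intro j hj
        rw [Finset.mem_Icc] at hj
        have := hall (n + 1 - j) (by omega)
        have h3 : n + 1 - (n + 1 - j) = j := by omega
        rwa [h3] at this
      have hnot : n + 1 ∉ Finset.Icc 1 n := by simp
      rw [hf] at ih
      rw [if_pos h, hf, Finset.sum_insert hnot, Finset.card_insert_of_notMem hnot, ih]
      simp only [Nat.card_Icc, Nat.add_sub_cancel]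
      push_cast
      have e1 : (n : ℝ) + 1 + i - 1 = i + n := by ring
      have h1 : (i : ℝ) + n ≠ 0 := by positivity
      have h2 : (i : ℝ) + (n + 1) ≠ 0 := by positivity
      have h3 : (n : ℝ) + 1 + i ≠ 0 := by positivity
      rw [e1]
      field_simp
      ring
    · rw [if_neg h, ih]


/-- decomposition of the AP loss over the negative samples. -/
theorem stmt_8 (p n : ℕ) (hp : 1 ≤ p) (hn : 1 ≤ n)
    (r : ℕ → ℕ)
    (hr : ∀ j ∈ Finset.Icc 1 n, r j ∈ Finset.Icc 1 (p + 1))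
    (hmono : ∀ j, 1 ≤ j → j < n → r j ≤ r (j + 1)) :
    1 - (1 / (p : ℝ)) * ∑ i ∈ Finset.Icc 1 p,
        ((i : ℝ) / ((i : ℝ) + ((((Finset.Icc 1 n).filter (fun j => r j ≤ i)).card : ℕ) : ℝ)))
    = ∑ j ∈ Finset.Icc 1 n, (1 / (p : ℝ)) * ∑ k ∈ Finset.Icc (r j) p,
        ((j : ℝ) / ((j : ℝ) + (k : ℝ)) - ((j : ℝ) - 1) / ((j : ℝ) + (k : ℝ) - 1)) := by
  have hp' : (p : ℝ) ≠ 0 := by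
    have : p ≠ 0 := by omega
    exact_mod_cast this
  rw [← Finset.mul_sum]
  have hswap : ∑ j ∈ Finset.Icc 1 n, ∑ k ∈ Finset.Icc (r j) p,
        ((j : ℝ) / ((j : ℝ) + (k : ℝ)) - ((j : ℝ) - 1) / ((j : ℝ) + (k : ℝ) - 1))
      = ∑ k ∈ Finset.Icc 1 p, ∑ j ∈ (Finset.Icc 1 n).filter (fun j => r j ≤ k),
        ((j : ℝ) / ((j : ℝ) + (k : ℝ)) - ((j : ℝ) - 1) / ((j : ℝ) + (k : ℝ) - 1)) := by
    apply Finset.sum_comm'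
    intro j k
    simp only [Finset.mem_Icc, Finset.mem_filter] at hr ⊢
    constructor
    · rintro ⟨h1, h2⟩
      have := hr j h1
      omega
    · rintro ⟨⟨h1, h2⟩, h3⟩
      omega
  rw [hswap, Finset.sum_congr rfl (fun k hk =>
    inner_tele k (Finset.mem_Icc.mp hk).1 r n hmono), Finset.sum_sub_distrib]
  simp only [Finset.sum_const, Nat.card_Icc, Nat.add_sub_cancel, nsmul_eq_mul, mul_one]
  rw [mul_sub, one_div_mul_cancel hp']
end

section
/- Let C > 0 and let T be a nonnegative real-valued function defined on pairs (n, p) of positive integers with n a power of 2. Assume: (i) T(n, 1) ≤ C·n for all powers of 2 n; (ii) T(1, p) = 0 for all p ≥ 1; and (iii) for every power of 2 n ≥ 2 and every p ≥ 2 there exist positive integers p₁, p₂ with p₁ + p₂ = p + 1 such that T(n, p) ≤ C·n + T(n/2, p₁) + T(n/2, p₂). Then there exists a constant C′ > 0, depending only on C, such that T(n, p) ≤ C′ · n · log(1 + p) for all powers of 2 n ≥ 1 and all integers p ≥ 1. -/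
/-- the recursion for `T_neg` implies `T n p ≤ C' n log (1 + p)`. -/
theorem stmt_12 (C : ℝ) (hC : 0 < C) :
    ∃ C' : ℝ, 0 < C' ∧
      ∀ T : ℕ → ℕ → ℝ,
        (∀ n p : ℕ, (∃ k, n = 2 ^ k) → 1 ≤ p → 0 ≤ T n p) →
        (∀ n : ℕ, (∃ k, n = 2 ^ k) → T n 1 ≤ C * n) →
        (∀ p : ℕ, 1 ≤ p → T 1 p = 0) →
        (∀ n p : ℕ, (∃ k, n = 2 ^ k) → 2 ≤ n → 2 ≤ p →
          ∃ p₁ p₂ : ℕ, 1 ≤ p₁ ∧ 1 ≤ p₂ ∧ p₁ + p₂ = p + 1 ∧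
            T n p ≤ C * n + T (n / 2) p₁ + T (n / 2) p₂) →
        ∀ n p : ℕ, (∃ k, n = 2 ^ k) → 1 ≤ p →
          T n p ≤ C' * n * Real.log (1 + p) := by
  have h2 : 0 < Real.log 2 := Real.log_pos (by norm_num)
  have h43 : 0 < Real.log (4 / 3) := Real.log_pos (by norm_num)
  obtain ⟨b, hb⟩ : ∃ b, b = C / Real.log (4 / 3) := ⟨_, rfl⟩
  have hb0 : 0 < b := by rw [hb]; positivity
  have hbC : b * Real.log (4 / 3) = C := by rw [hb]; field_simp
  refine ⟨C / Real.log 2 + b, by positivity, ?_⟩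
  intro T _ h1 hone hrec
  have key : ∀ k p : ℕ, 1 ≤ p → T (2 ^ k) p ≤ 2 ^ k * (C + b * Real.log p) := by
    intro k
    induction k with
    | zero =>
      intro p hp
      have hl : 0 ≤ Real.log (p : ℝ) := Real.log_natCast_nonneg p
      rw [pow_zero, hone p hp]
      positivity
    | succ k ih =>
      intro p hp
      rcases Nat.lt_or_ge p 2 with hlt | hge
      · have : p = 1 := by omega
        subst this
        have := h1 (2 ^ (k + 1)) ⟨_, rfl⟩
        push_cast at this
        simp only [Nat.cast_one, Real.log_one, mul_zero, add_zero]
        linarith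
      · have hn2 : 2 ≤ 2 ^ (k + 1) := by
          have := Nat.one_le_two_pow (n := k)
          rw [pow_succ]; omega
        obtain ⟨p₁, p₂, hp1, hp2, hsum, hT⟩ := hrec (2 ^ (k + 1)) p ⟨_, rfl⟩ hn2 hge
        have hdiv : 2 ^ (k + 1) / 2 = 2 ^ k := by rw [pow_succ]; omega
        rw [hdiv] at hT
        have i1 := ih p₁ hp1
        have i2 := ih p₂ hp2
        have r1 : (1 : ℝ) ≤ p₁ := by exact_mod_cast hp1
        have r2 : (1 : ℝ) ≤ p₂ := by exact_mod_cast hp2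
        have rp : (2 : ℝ) ≤ p := by exact_mod_cast hge
        have rs : (p₁ : ℝ) + p₂ = p + 1 := by exact_mod_cast hsum
        have hprod : (4 / 3 : ℝ) * (4 / 3) * (p₁ * p₂) ≤ p * p := by
          have a1 : 4 * ((p₁ : ℝ) * p₂) ≤ (p + 1) ^ 2 := by
            rw [← rs]; nlinarith [sq_nonneg ((p₁ : ℝ) - p₂)]
          nlinarith
        have hlog := Real.log_le_log (by positivity) hprod
        rw [Real.log_mul (by positivity) (by positivity),
          Real.log_mul (by positivity) (by positivity),
          Real.log_mul (by positivity) (by positivity),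
          Real.log_mul (by positivity) (by positivity)] at hlog
        have hlb := mul_le_mul_of_nonneg_left hlog hb0.le
        have hfin : 2 * C + b * Real.log p₁ + b * Real.log p₂ ≤ 2 * (b * Real.log p) := by
          linarith
        have hk : (0 : ℝ) ≤ 2 ^ k := by positivity
        have hm := mul_le_mul_of_nonneg_left hfin hk
        push_cast at hT
        have hps : (2 : ℝ) ^ (k + 1) = 2 ^ k * 2 := pow_succ _ _
        rw [hps] at hT ⊢
        linarith
  rintro n p ⟨k, rfl⟩ hp
  refine (key k p hp).trans ?_
  have rp : (1 : ℝ) ≤ p := by exact_mod_cast hp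
  have l1 : Real.log 2 ≤ Real.log (1 + p) := Real.log_le_log (by norm_num) (by linarith)
  have l2 : Real.log p ≤ Real.log (1 + p) := Real.log_le_log (by linarith) (by linarith)
  have e1 : C ≤ C / Real.log 2 * Real.log (1 + p) := by
    calc C = C / Real.log 2 * Real.log 2 := by field_simp
      _ ≤ _ := mul_le_mul_of_nonneg_left l1 (by positivity)
  have e2 := mul_le_mul_of_nonneg_left l2 hb0.le
  have hk : (0 : ℝ) ≤ 2 ^ k := by positivity
  have := mul_le_mul_of_nonneg_left (add_le_add e1 e2) hk
  push_cast
  linarith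
end

section
/- Let C > 0 and let T be a nonnegative real-valued function defined on pairs (n, p) of positive integers with n a power of 2. Assume: (i) T(n, 1) = 0 for all powers of 2 n; (ii) T(1, p) ≤ C·p for all p ≥ 1; and (iii) for every power of 2 n ≥ 2 and every p ≥ 2 there exist positive integers p₁, p₂ with p₁ + p₂ = p + 1 such that T(n, p) ≤ C·p + T(n/2, p₁) + T(n/2, p₂). Then there exists a constant C′ > 0, depending only on C, such that T(n, p) ≤ C′ · (p − 1) · log(1 + n) for all powers of 2 n ≥ 1 and all integers p ≥ 1. -/
/-- the recursion for `T_pos` implies `T n p ≤ C' (p - 1) log (1 + n)`. -/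
theorem stmt_13 (C : ℝ) (hC : 0 < C) :
    ∃ C' : ℝ, 0 < C' ∧
      ∀ T : ℕ → ℕ → ℝ,
        (∀ n p : ℕ, (∃ k, n = 2 ^ k) → 1 ≤ p → 0 ≤ T n p) →
        (∀ n : ℕ, (∃ k, n = 2 ^ k) → T n 1 = 0) →
        (∀ p : ℕ, 1 ≤ p → T 1 p ≤ C * p) →
        (∀ n p : ℕ, (∃ k, n = 2 ^ k) → 2 ≤ n → 2 ≤ p →
          ∃ p₁ p₂ : ℕ, 1 ≤ p₁ ∧ 1 ≤ p₂ ∧ p₁ + p₂ = p + 1 ∧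
            T n p ≤ C * p + T (n / 2) p₁ + T (n / 2) p₂) →
        ∀ n p : ℕ, (∃ k, n = 2 ^ k) → 1 ≤ p →
          T n p ≤ C' * ((p : ℝ) - 1) * Real.log (1 + n) := by
  
  refine ⟨8 * C, by positivity, ?_⟩
  intro T _ h1 h2 h3
  have key : ∀ k p : ℕ, 1 ≤ p → T (2 ^ k) p ≤ 2 * C * ((p : ℝ) - 1) * (k + 1) := by
    intro k
    induction k with
    | zero =>
      intro p hp
      rcases Nat.lt_or_ge p 2 with h | h
      · obtain rfl : p = 1 := by omega
        rw [h1 _ ⟨0, rfl⟩]; simp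
      · have hp2 : (2 : ℝ) ≤ p := by exact_mod_cast h
        have := h2 p hp
        simp only [pow_zero, Nat.cast_zero]
        nlinarith
    | succ k ih =>
      intro p hp
      rcases Nat.lt_or_ge p 2 with h | h
      · obtain rfl : p = 1 := by omega
        rw [h1 _ ⟨k + 1, rfl⟩]; simp
      · have hp2 : (2 : ℝ) ≤ p := by exact_mod_cast h
        have hn : 2 ≤ 2 ^ (k + 1) := by
          have := Nat.one_le_two_pow (n := k)
          rw [pow_succ]; omega
        obtain ⟨a, b, ha, hb, hab, hT⟩ := h3 (2 ^ (k + 1)) p ⟨k + 1, rfl⟩ hn h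
        have hd : 2 ^ (k + 1) / 2 = 2 ^ k := by rw [pow_succ]; omega
        rw [hd] at hT
        have i1 := ih a ha
        have i2 := ih b hb
        have hab' : (b : ℝ) = p + 1 - a := by
          have : (a : ℝ) + b = p + 1 := by exact_mod_cast hab
          linarith
        rw [hab'] at i2
        push_cast
        have : C * p ≤ 2 * C * ((p : ℝ) - 1) := by nlinarith
        linarith
  rintro n p ⟨k, rfl⟩ hp
  have hk := key k p hp
  have hp1 : (1 : ℝ) ≤ p := by exact_mod_cast hp
  have hlog : ((k : ℝ) + 1) / 4 ≤ Real.log (1 + ((2 ^ k : ℕ) : ℝ)) := by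
    have hl2 := Real.log_two_gt_d9
    have hpow : (1 : ℝ) ≤ 2 ^ k := one_le_pow₀ (by norm_num)
    have a1 : Real.log 2 ≤ Real.log (1 + ((2 ^ k : ℕ) : ℝ)) := by
      apply Real.log_le_log (by norm_num)
      push_cast; linarith
    have a2 : (k : ℝ) * Real.log 2 ≤ Real.log (1 + ((2 ^ k : ℕ) : ℝ)) := by
      rw [← Real.log_pow]
      apply Real.log_le_log (by positivity)
      push_cast; linarith
    have hk0 : (0 : ℝ) ≤ k := Nat.cast_nonneg k
    nlinarith
  have h0 : 0 ≤ 8 * C * ((p : ℝ) - 1) := mul_nonneg (by positivity) (by linarith)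
  have := mul_le_mul_of_nonneg_left hlog h0
  linarith
end
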